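/- Suppose T is a compact operator with closed range and consider the linearly constrained problem: minimize f(x) over F = {x ∈ H : ⟨c_i, x⟩ + α_i ≤ 0 for all i = 1,…,m}. If F is nonempty and f is bounded from below on F, then f attains its infimum on F. -/

import Mathlib

open scoped RealInnerProductSpace
open Filter Topology

/-- A sequence `x` in a real inner product space converges weakly to `x₀` if
`⟪a, x k⟫ → ⟪a, x₀⟫` for every `a`. -/
def WeaklyConvergesTo {H : Type*} [NormedAddCommGroup H] [InnerProductSpace ℝ H]
    (x : ℕ → H) (x₀ : H) : Prop :=
  ∀ a : H, Tendsto (fun k => ⟪a, x k⟫) atTop (𝓝 ⟪a, x₀⟫)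

/-- A (continuous linear) operator is compact if it maps every weakly convergent sequence
to a strongly convergent sequence. -/
def CompactOp {H : Type*} [NormedAddCommGroup H] [InnerProductSpace ℝ H]
    (A : H →L[ℝ] H) : Prop :=
  ∀ (x : ℕ → H) (x₀ : H), WeaklyConvergesTo x x₀ →
    Tendsto (fun k => A (x k)) atTop (𝓝 (A x₀))

/-- A real quadratic with nonpositive leading coefficient that is bounded below on `[0, ∞)` is
affine with nonnegative slope. -/
lemma quadratic_bddBelow_coeffs {a b q l : ℝ} (hq : q ≤ 0)
    (h : ∀ t : ℝ, 0 ≤ t → l ≤ a + t * b + t ^ 2 * q) : q = 0 ∧ 0 ≤ b := by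
  have hq0 : q = 0 := by
    by_contra hne
    have hneg : q < 0 := lt_of_le_of_ne hq hne
    set t : ℝ := (|b| + |a - l| + 1) / (-q) + 1 with ht
    have hpos : 0 ≤ (|b| + |a - l| + 1) / (-q) := by
      have : 0 < -q := by linarith
      positivity
    have htq : t * q = -(|b| + |a - l| + 1) + q := by
      rw [ht]; field_simp
    have h1 := h t (by linarith)
    have h2 : t ^ 2 * q = t * (-(|b| + |a - l| + 1) + q) := by rw [← htq]; ring
    have h3 : 1 ≤ t := by linarith
    have h4 : t * b ≤ t * |b| := mul_le_mul_of_nonneg_left (le_abs_self b) (by linarith)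
    nlinarith [le_abs_self (a - l), abs_nonneg (a - l), mul_nonneg (sub_nonneg.2 h3)
      (abs_nonneg (a - l))]
  refine ⟨hq0, ?_⟩
  by_contra! hb
  have hpos : 0 ≤ (|a - l| + 1) / (-b) := by
    have : 0 < -b := by linarith
    positivity
  have h1 := h _ hpos
  have h2 : (|a - l| + 1) / (-b) * b = -(|a - l| + 1) := by
    rw [div_mul_eq_mul_div, div_eq_iff (by linarith)]; ring
  rw [h2, hq0] at h1
  linarith [le_abs_self (a - l)]

lemma quadratic_add_smul {E : Type*} [NormedAddCommGroup E] [InnerProductSpace ℝ E]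
    {T : E →L[ℝ] E} (hT : ∀ x y : E, ⟪T x, y⟫ = ⟪x, T y⟫) (c x d : E) (t : ℝ) :
    (1/2 : ℝ) * ⟪x + t • d, T (x + t • d)⟫ + ⟪c, x + t • d⟫ =
      ((1/2 : ℝ) * ⟪x, T x⟫ + ⟪c, x⟫) + t * (⟪x, T d⟫ + ⟪c, d⟫)
        + t ^ 2 * ((1/2 : ℝ) * ⟪d, T d⟫) := by
  have h : ⟪d, T x⟫ = ⟪x, T d⟫ := by rw [← hT, real_inner_comm]
  simp only [map_add, map_smul, inner_add_left, inner_add_right, real_inner_smul_left,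
    real_inner_smul_right, h]
  ring

/-- On a nonempty closed set of a proper space, a continuous function has minimizers over balls, and
one of them has minimal norm. -/
lemma exists_minimizer_closedBall_of_minimal_norm {E : Type*} [NormedAddCommGroup E]
    [ProperSpace E] {f : E → ℝ} (hf : Continuous f) {F : Set E} (hF : IsClosed F)
    {r : ℝ} (hne : ∃ x ∈ F, ‖x‖ ≤ r) :
    ∃ z ∈ F, ‖z‖ ≤ r ∧ (∀ y ∈ F, ‖y‖ ≤ r → f z ≤ f y) ∧
      ∀ y ∈ F, ‖y‖ ≤ r → f y ≤ f z → ‖z‖ ≤ ‖y‖ := by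
  obtain ⟨x₀, hx₀, hx₀r⟩ := hne
  have hK : IsCompact (F ∩ Metric.closedBall 0 r) :=
    (isCompact_closedBall 0 r).inter_left hF
  obtain ⟨w, hw, hwmin⟩ := hK.exists_isMinOn ⟨x₀, hx₀, by simpa using hx₀r⟩ hf.continuousOn
  have hK' : IsCompact ((F ∩ Metric.closedBall 0 r) ∩ {x | f x ≤ f w}) :=
    hK.inter_right (isClosed_le hf continuous_const)
  obtain ⟨z, ⟨⟨hzF, hzr⟩, hzw⟩, hzmin⟩ :=
    hK'.exists_isMinOn ⟨w, hw, le_refl (f w)⟩ continuous_norm.continuousOn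
  have hzw : f z ≤ f w := hzw
  refine ⟨z, hzF, by simpa using hzr, fun y hy hyr => ?_, fun y hy hyr hyz => ?_⟩
  · exact hzw.trans (hwmin ⟨hy, by simpa using hyr⟩)
  · exact hzmin ⟨⟨hy, by simpa using hyr⟩, hyz.trans hzw⟩

/-- **Frank–Wolfe theorem**: a quadratic function bounded below on a nonempty polyhedron of a
finite-dimensional space attains its minimum there. -/
theorem frank_wolfe {E : Type*} [NormedAddCommGroup E] [InnerProductSpace ℝ E]
    [FiniteDimensional ℝ E] {ι : Type*} [Finite ι]
    (T : E →L[ℝ] E) (hT : ∀ x y : E, ⟪T x, y⟫ = ⟪x, T y⟫) (c : E)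
    (a : ι → E) (α : ι → ℝ) (f : E → ℝ) (hf : ∀ x, f x = (1/2 : ℝ) * ⟪x, T x⟫ + ⟪c, x⟫)
    (F : Set E) (hF : F = {x : E | ∀ i, ⟪a i, x⟫ + α i ≤ 0})
    (hne : F.Nonempty) (hbd : BddBelow (f '' F)) :
    ∃ z ∈ F, ∀ x ∈ F, f z ≤ f x := by
  have : ProperSpace E := FiniteDimensional.proper ℝ E
  have memF (x : E) : x ∈ F ↔ ∀ i, ⟪a i, x⟫ + α i ≤ 0 := by rw [hF]; rfl
  have hfc : Continuous f := by
    rw [funext hf]; fun_prop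
  have hFc : IsClosed F := by
    rw [hF, Set.ofPred_forall]
    exact isClosed_iInter fun i => isClosed_le (by fun_prop) continuous_const
  obtain ⟨l, hl⟩ := hbd
  replace hl (x : E) (hx : x ∈ F) : l ≤ f x := hl ⟨x, hx, rfl⟩
  obtain ⟨x₀, hx₀⟩ := hne
  have hex (k : ℕ) := exists_minimizer_closedBall_of_minimal_norm hfc hFc
    (r := ‖x₀‖ + k) ⟨x₀, hx₀, by simp⟩
  choose x hxF hxr hxmin hxnorm using hex
  by_contra! hno
  have hlarge : Tendsto (fun k => ‖x k‖) atTop atTop := by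
    by_contra hnot
    obtain ⟨M, hM⟩ : ∃ M, ∃ᶠ k in atTop, ‖x k‖ < M := by
      simpa [tendsto_atTop, Filter.Frequently] using hnot
    obtain ⟨k₀, hk₀⟩ := hM.exists
    obtain ⟨z, hzF, -, hzmin, -⟩ := exists_minimizer_closedBall_of_minimal_norm hfc hFc
      ⟨x k₀, hxF k₀, hk₀.le⟩
    obtain ⟨y, hyF, hy⟩ := hno z hzF
    obtain ⟨N, hN⟩ := exists_nat_ge ‖y‖
    obtain ⟨k, hkM, hkN⟩ := (hM.and_eventually (eventually_ge_atTop N)).exists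
    have hkN' : (N : ℝ) ≤ k := by exact_mod_cast hkN
    have h1 := hxmin k y hyF (by linarith [norm_nonneg x₀])
    have h2 := hzmin (x k) (hxF k) hkM.le
    linarith
  have hsphere : ∀ᶠ k in atTop, ‖x k‖⁻¹ • x k ∈ Metric.sphere (0 : E) 1 := by
    filter_upwards [hlarge.eventually_gt_atTop 0] with k hk
    simp [norm_smul, hk.ne']
  obtain ⟨d, hd, φ, hφ, hlim⟩ :=
    (isCompact_sphere (0 : E) 1).tendsto_subseq' hsphere.frequently
  have hd1 : ‖d‖ = 1 := by simpa using hd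
  have hlargeφ : Tendsto (fun k => ‖x (φ k)‖) atTop atTop := hlarge.comp hφ.tendsto_atTop
  have hinv : Tendsto (fun k => ‖x (φ k)‖⁻¹) atTop (𝓝 0) := hlargeφ.inv_tendsto_atTop
  have hinner (b : E) : Tendsto (fun k => ‖x (φ k)‖⁻¹ * ⟪b, x (φ k)⟫) atTop (𝓝 ⟪b, d⟫) := by
    simpa [real_inner_smul_right] using (tendsto_const_nhds (x := b)).inner (𝕜 := ℝ) hlim
  have hrec (i : ι) : ⟪a i, d⟫ ≤ 0 := by
    have h := (hinner (a i)).add (hinv.mul_const (α i))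
    rw [zero_mul, add_zero] at h
    refine le_of_tendsto' h fun k => ?_
    rw [← mul_add]
    exact mul_nonpos_of_nonneg_of_nonpos (by positivity) ((memF _).1 (hxF _) i)
  have hquad : (1/2 : ℝ) * ⟪d, T d⟫ ≤ 0 := by
    have h1 : Tendsto (fun k => (1/2 : ℝ) * ⟪‖x (φ k)‖⁻¹ • x (φ k), T (‖x (φ k)‖⁻¹ • x (φ k))⟫
        + ‖x (φ k)‖⁻¹ * (‖x (φ k)‖⁻¹ * ⟪c, x (φ k)⟫)) atTop
        (𝓝 ((1/2 : ℝ) * ⟪d, T d⟫ + 0 * ⟪c, d⟫)) :=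
      ((hlim.inner (𝕜 := ℝ) ((T.continuous.tendsto d).comp hlim)).const_mul _).add
        (hinv.mul (hinner c))
    have h2 : Tendsto (fun k => ‖x (φ k)‖⁻¹ * (‖x (φ k)‖⁻¹ * f x₀)) atTop (𝓝 (0 * (0 * f x₀))) :=
      hinv.mul (hinv.mul_const _)
    have h := le_of_tendsto_of_tendsto' h1 h2 fun k => ?_
    · simpa using h
    · have hk := hxmin (φ k) x₀ hx₀ (by simp)
      have hpos : 0 ≤ ‖x (φ k)‖⁻¹ * ‖x (φ k)‖⁻¹ := by positivity
      have := mul_le_mul_of_nonneg_left hk hpos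
      rw [hf (x (φ k))] at this
      simp only [map_smul, real_inner_smul_left, real_inner_smul_right]
      linarith
  have hray (y : E) (hy : y ∈ F) : (1/2 : ℝ) * ⟪d, T d⟫ = 0 ∧ 0 ≤ ⟪y, T d⟫ + ⟪c, d⟫ := by
    refine quadratic_bddBelow_coeffs (a := (1/2 : ℝ) * ⟪y, T y⟫ + ⟪c, y⟫) (l := l) hquad
      fun t ht => ?_
    rw [← quadratic_add_smul hT, ← hf]
    refine hl _ ((memF _).2 fun i => ?_)
    rw [inner_add_right, real_inner_smul_right]
    linarith [(memF y).1 hy i, mul_nonpos_of_nonneg_of_nonpos ht (hrec i)]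
  have hslack (i : ι) : ∀ᶠ k in atTop, ∀ᶠ t in 𝓝[>] (0 : ℝ),
      ⟪a i, x (φ k) + (-t) • d⟫ + α i ≤ 0 := by
    rcases (hrec i).eq_or_lt with h0 | hneg
    · refine Eventually.of_forall fun k => Eventually.of_forall fun t => ?_
      rw [inner_add_right, real_inner_smul_right, h0]
      simpa using (memF _).1 (hxF (φ k)) i
    · have h := (hinner (a i)).add (hinv.mul_const (α i))
      rw [zero_mul, add_zero] at h
      filter_upwards [h.eventually_lt_const hneg, hlargeφ.eventually_gt_atTop 0] with k hk hk0
      rw [← mul_add] at hk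
      have hk' : ⟪a i, x (φ k)⟫ + α i < 0 := by
        by_contra! hcon
        exact absurd hk (not_lt.2 (by positivity))
      have hcont : Continuous fun t : ℝ => ⟪a i, x (φ k) + (-t) • d⟫ + α i := by fun_prop
      have hev := (hcont.tendsto 0).eventually_lt_const (u := 0) (by simpa using hk')
      exact (hev.filter_mono nhdsWithin_le_nhds).mono fun t ht => ht.le
  have hdd : (0 : ℝ) < ⟪d, d⟫ := by rw [real_inner_self_eq_norm_sq, hd1]; norm_num
  obtain ⟨k, hk, hkd, hk0⟩ := ((eventually_all.2 hslack).and
    (((hinner d).eventually_const_lt hdd).and (hlargeφ.eventually_gt_atTop 0))).exists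
  have hxd : 0 < ⟪d, x (φ k)⟫ := pos_of_mul_pos_right hkd (by positivity)
  obtain ⟨t, ht, ht0, htd⟩ := ((eventually_all.2 hk).and
    ((eventually_mem_nhdsWithin).and
      ((eventually_lt_nhds hxd).filter_mono nhdsWithin_le_nhds))).exists
  have ht0 : 0 < t := ht0
  have hyF : x (φ k) + (-t) • d ∈ F := (memF _).2 ht
  have hynorm : ‖x (φ k) + (-t) • d‖ < ‖x (φ k)‖ := by
    refine lt_of_pow_lt_pow_left₀ 2 (norm_nonneg _) ?_
    rw [norm_add_sq_real, norm_smul, real_inner_smul_right, hd1, real_inner_comm]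
    simp only [norm_neg, Real.norm_eq_abs, mul_one, sq_abs]
    nlinarith [mul_lt_mul_of_pos_left htd ht0]
  have hyf : f (x (φ k) + (-t) • d) ≤ f (x (φ k)) := by
    obtain ⟨h1, h2⟩ := hray _ (hxF (φ k))
    rw [hf, quadratic_add_smul hT, h1, hf]
    nlinarith [mul_nonneg ht0.le h2]
  exact absurd (hxnorm (φ k) _ hyF (hynorm.le.trans (hxr _)) hyf) (not_le.2 hynorm)

lemma Orthonormal.weaklyConvergesTo_zero {H : Type*} [NormedAddCommGroup H]
    [InnerProductSpace ℝ H] {e : ℕ → H} (he : Orthonormal ℝ e) : WeaklyConvergesTo e 0 := by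
  intro a
  have h := (he.inner_products_summable a).tendsto_atTop_zero
  have h' := h.sqrt
  simp only [Real.sqrt_sq (norm_nonneg _), Real.sqrt_zero] at h'
  rw [inner_zero_right, tendsto_zero_iff_norm_tendsto_zero]
  simpa only [real_inner_comm] using h'

/-- An infinite-dimensional inner product space contains an orthonormal sequence. -/
lemma exists_orthonormal_nat_of_not_finiteDimensional {E : Type*} [NormedAddCommGroup E]
    [InnerProductSpace ℝ E] (h : ¬ FiniteDimensional ℝ E) : ∃ e : ℕ → E, Orthonormal ℝ e := by
  have hb : Infinite (Module.Basis.ofVectorSpaceIndex ℝ E) := by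
    by_contra hfin
    rw [not_infinite_iff_finite] at hfin
    exact h (Module.Finite.of_basis (Module.Basis.ofVectorSpace ℝ E))
  let g := Infinite.natEmbedding (Module.Basis.ofVectorSpaceIndex ℝ E)
  exact ⟨_, InnerProductSpace.gramSchmidtNormed_orthonormal
    ((Module.Basis.ofVectorSpace ℝ E).linearIndependent.comp g g.injective)⟩

/-- A self-adjoint operator with closed range is bounded below on its range. -/
lemma exists_norm_le_mul_norm_of_mem_range {H : Type*} [NormedAddCommGroup H]
    [InnerProductSpace ℝ H] [CompleteSpace H] {T : H →L[ℝ] H}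
    (hT : ∀ x y : H, ⟪T x, y⟫ = ⟪x, T y⟫) (hTr : IsClosed (T.range : Set H)) :
    ∃ K : ℝ, ∀ x ∈ T.range, ‖x‖ ≤ K * ‖T x‖ := by
  have hcomp : CompleteSpace T.range := hTr.completeSpace_coe
  let S : T.range →L[ℝ] T.range :=
    (T.comp T.range.subtypeL).codRestrict T.range fun x => ⟨x, rfl⟩
  have hinj : S.ker = ⊥ := by
    refine LinearMap.ker_eq_bot'.2 fun x hx => ?_
    obtain ⟨y, hy⟩ := x.2
    have h0 : T (x : H) = 0 := congrArg Subtype.val hx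
    have h1 : ⟪(x : H), (x : H)⟫ = 0 := by
      nth_rewrite 1 [← hy]
      exact (hT y x).trans (by rw [h0, inner_zero_right])
    exact Subtype.ext (inner_self_eq_zero.1 h1)
  have hsurj : S.range = ⊤ := by
    refine LinearMap.range_eq_top.2 fun x => ?_
    obtain ⟨y, hy⟩ := x.2
    obtain ⟨v, hv, w, hw, rfl⟩ := T.range.exists_add_mem_mem_orthogonal y
    have hw0 : T w = 0 := inner_self_eq_zero (𝕜 := ℝ).1 <|
      (hT w (T w)).trans ((real_inner_comm _ _).trans (hw _ ⟨T w, rfl⟩))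
    refine ⟨⟨v, hv⟩, Subtype.ext ?_⟩
    have hy : T (v + w) = x := hy
    rw [map_add, hw0, add_zero] at hy
    exact hy
  let e := ContinuousLinearEquiv.ofBijective S hinj hsurj
  refine ⟨‖(e.symm : T.range →L[ℝ] T.range)‖, fun x hx => ?_⟩
  have h := (e.symm : T.range →L[ℝ] T.range).le_opNorm (e ⟨x, hx⟩)
  rw [ContinuousLinearEquiv.coe_coe, e.symm_apply_apply] at h
  exact h

lemma CompactOp.finiteDimensional_range {H : Type*} [NormedAddCommGroup H]
    [InnerProductSpace ℝ H] [CompleteSpace H] {T : H →L[ℝ] H} (hTc : CompactOp T)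
    (hT : ∀ x y : H, ⟪T x, y⟫ = ⟪x, T y⟫) (hTr : IsClosed (T.range : Set H)) :
    FiniteDimensional ℝ T.range := by
  by_contra h
  obtain ⟨e, he⟩ := exists_orthonormal_nat_of_not_finiteDimensional h
  obtain ⟨K, hK⟩ := exists_norm_le_mul_norm_of_mem_range hT hTr
  have he' : Orthonormal ℝ (fun n => (e n : H)) := he.comp_linearIsometry T.range.subtypeₗᵢ
  have hlim := ((hTc _ _ he'.weaklyConvergesTo_zero).norm).const_mul K
  rw [map_zero, norm_zero, mul_zero] at hlim
  have h1 : (1 : ℝ) ≤ 0 := ge_of_tendsto' hlim fun n => by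
    simpa [he'.norm_eq_one n] using hK _ (e n).2
  linarith

/-- Linearly constrained case with compact operator: if `T` is compact with closed range,
`F` (defined by linear inequalities) is nonempty and `f` is bounded from below on `F`,
then `f` attains its infimum on `F`. -/
theorem compact_linear_constraints
    {H : Type*} [NormedAddCommGroup H] [InnerProductSpace ℝ H] [CompleteSpace H]
    {m : ℕ} (T : H →L[ℝ] H) (hT_sa : ∀ x y : H, ⟪T x, y⟫ = ⟪x, T y⟫) (c : H)
    (ci : Fin m → H) (α : Fin m → ℝ)
    (f : H → ℝ) (hf : ∀ x, f x = (1/2 : ℝ) * ⟪x, T x⟫ + ⟪c, x⟫)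
    (F : Set H)
    (hF : F = {x : H | ∀ i, ⟪ci i, x⟫ + α i ≤ 0})
    (hTc : CompactOp T) (hTr : IsClosed (Set.range fun x => T x))
    (hne : F.Nonempty) (hbd : BddBelow (f '' F)) :
    ∃ xbar ∈ F, ∀ x ∈ F, f xbar ≤ f x := by
  have hfin : FiniteDimensional ℝ T.range := hTc.finiteDimensional_range hT_sa hTr
  let V : Submodule ℝ H := T.range ⊔ Submodule.span ℝ (Set.range (Option.elim · c ci))
  have hVfin : FiniteDimensional ℝ V := by
    have := FiniteDimensional.span_of_finite ℝ (Set.finite_range (Option.elim · c ci))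
    exact Submodule.finiteDimensional_sup _ _
  have hTV (x : H) : T x ∈ V := Submodule.mem_sup_left ⟨x, rfl⟩
  have hcV : c ∈ V := Submodule.mem_sup_right (Submodule.subset_span ⟨none, rfl⟩)
  have hciV (i : Fin m) : ci i ∈ V :=
    Submodule.mem_sup_right (Submodule.subset_span ⟨some i, rfl⟩)
  have hproj (v : H) (hv : v ∈ V) (x : H) : ⟪v, V.starProjection x⟫ = ⟪v, x⟫ := by
    rw [← Submodule.inner_starProjection_left_eq_right, Submodule.starProjection_eq_self_iff.2 hv]
  have hfproj (x : H) : f (V.starProjection x) = f x := by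
    have hquad : ⟪V.starProjection x, T (V.starProjection x)⟫ = ⟪x, T x⟫ := by
      rw [← hT_sa, hproj _ (hTV _), hT_sa, real_inner_comm, hproj _ (hTV _), hT_sa]
    rw [hf, hf, hproj c hcV, hquad]
  have hFproj (x : H) (hx : x ∈ F) : V.starProjection x ∈ F := by
    rw [hF] at hx ⊢
    intro i
    rw [hproj _ (hciV i)]
    exact hx i
  obtain ⟨z, hzF, hz⟩ := frank_wolfe ((T.comp V.subtypeL).codRestrict V fun x => hTV x)
    (fun x y => hT_sa x y) ⟨c, hcV⟩ (fun i => ⟨ci i, hciV i⟩) α (fun x => f x) (fun x => hf x)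
    {x : V | (x : H) ∈ F} (by rw [hF]; rfl)
    (hne.imp' (fun x => V.orthogonalProjectionOnto x) hFproj)
    (hbd.mono (by rintro _ ⟨x, hx, rfl⟩; exact ⟨x, hx, rfl⟩))
  refine ⟨z, hzF, fun x hx => ?_⟩
  rw [← hfproj x]
  exact hz (V.orthogonalProjectionOnto x) (hFproj x hx)
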